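/- Every small filtered category is aspherical: its nerve is weakly equivalent to a point. -/

import Mathlib

open CategoryTheory

namespace FilteredAspherical

open unitInterval

/-- affine interpolation in the standard simplex -/
noncomputable def mix {ι : Type} [Fintype ι] (t : I) (p q : stdSimplex ℝ ι) : stdSimplex ℝ ι :=
  ⟨fun k => (1 - (t : ℝ)) * p k + (t : ℝ) * q k, by
    constructor
    · intro k
      have h1 := t.2.1
      have h2 := t.2.2
      have h3 := stdSimplex.zero_le p k
      have h4 := stdSimplex.zero_le q k
      have : 0 ≤ 1 - (t : ℝ) := by linarith
      positivity
    · rw [Finset.sum_add_distrib, ← Finset.mul_sum, ← Finset.mul_sum, stdSimplex.sum_eq_one,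
        stdSimplex.sum_eq_one]
      ring⟩

lemma mix_apply {ι : Type} [Fintype ι] (t : I) (p q : stdSimplex ℝ ι) (k : ι) :
    mix t p q k = (1 - (t : ℝ)) * p k + (t : ℝ) * q k := rfl

lemma map_apply {ι κ : Type} [Fintype ι] [Fintype κ] [DecidableEq κ] (f : ι → κ)
    (p : stdSimplex ℝ ι) (k : κ) :
    stdSimplex.map f p k = ∑ i with f i = k, p i := by
  have := congrFun (stdSimplex.map_coe f p) k
  rw [FunOnFinite.linearMap_apply_apply] at this
  convert this

lemma mix_continuous {ι : Type} [Fintype ι] :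
    Continuous (fun x : I × stdSimplex ℝ ι × stdSimplex ℝ ι => mix x.1 x.2.1 x.2.2) := by
  apply Continuous.subtype_mk
  apply continuous_pi
  intro k
  have h1 : Continuous (fun x : I × stdSimplex ℝ ι × stdSimplex ℝ ι => x.2.1 k) :=
    (continuous_apply k).comp (continuous_subtype_val.comp (continuous_fst.comp continuous_snd))
  have h2 : Continuous (fun x : I × stdSimplex ℝ ι × stdSimplex ℝ ι => x.2.2 k) :=
    (continuous_apply k).comp (continuous_subtype_val.comp (continuous_snd.comp continuous_snd))
  have h3 : Continuous (fun x : I × stdSimplex ℝ ι × stdSimplex ℝ ι => (x.1 : ℝ)) :=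
    continuous_subtype_val.comp continuous_fst
  fun_prop

lemma sext {ι : Type} [Fintype ι] {p q : stdSimplex ℝ ι} (h : ∀ k, p k = q k) : p = q :=
  stdSimplex.ext (funext h)

lemma map_mix {ι κ : Type} [Fintype ι] [Fintype κ] [DecidableEq κ] (f : ι → κ)
    (t : I) (p q : stdSimplex ℝ ι) :
    stdSimplex.map f (mix t p q) = mix t (stdSimplex.map f p) (stdSimplex.map f q) := by
  apply sext
  intro k
  simp only [map_apply, mix_apply, Finset.sum_add_distrib, Finset.mul_sum]

lemma mix_zero {ι : Type} [Fintype ι] (p q : stdSimplex ℝ ι) : mix 0 p q = p :=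
  sext fun k => by simp [mix_apply]

lemma mix_one {ι : Type} [Fintype ι] (p q : stdSimplex ℝ ι) : mix 1 p q = q :=
  sext fun k => by simp [mix_apply]

lemma map_inj_apply {ι κ : Type} [Fintype ι] [Fintype κ] (f : ι → κ)
    (hf : Function.Injective f) (p : stdSimplex ℝ ι) (i : ι) :
    stdSimplex.map f p (f i) = p i := by
  classical
  rw [map_apply, Finset.sum_eq_single_of_mem i (by simp)]
  intro j hj hne
  exact absurd (hf (by simpa using hj)) hne

lemma map_inj {ι κ : Type} [Fintype ι] [Fintype κ] (f : ι → κ)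
    (hf : Function.Injective f) {p q : stdSimplex ℝ ι}
    (h : stdSimplex.map f p = stdSimplex.map f q) : p = q :=
  sext fun k => by rw [← map_inj_apply f hf p, h, map_inj_apply f hf]

lemma map_succAbove_self {n : ℕ} (i : Fin (n + 1)) (p : stdSimplex ℝ (Fin n)) :
    stdSimplex.map i.succAbove p i = 0 := by
  rw [map_apply]
  apply Finset.sum_eq_zero
  intro j hj
  simp at hj

lemma exists_face {n : ℕ} (x : stdSimplex ℝ (Fin (n + 1))) (i : Fin (n + 1)) (hx : x i = 0) :
    ∃ r : stdSimplex ℝ (Fin n), stdSimplex.map i.succAbove r = x := by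
  refine ⟨⟨fun k => x (i.succAbove k), fun k => stdSimplex.zero_le x _, ?_⟩, ?_⟩
  · have := stdSimplex.sum_eq_one x
    rw [Fin.sum_univ_succAbove _ i, hx, zero_add] at this
    exact this
  · apply sext
    intro k
    rcases Fin.eq_self_or_eq_succAbove i k with rfl | ⟨j, rfl⟩
    · rw [map_succAbove_self, hx]
    · rw [map_inj_apply _ i.succAbove_right_injective]
      rfl

/-- Parametrization of the simplex as a cone over its boundary. -/
noncomputable def par (n : ℕ) (x : Σ _ : Fin (n + 2), I × stdSimplex ℝ (Fin (n + 1))) :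
    stdSimplex ℝ (Fin (n + 2)) :=
  mix x.2.1 (stdSimplex.map x.1.succAbove x.2.2) stdSimplex.barycenter

lemma par_continuous (n : ℕ) : Continuous (par n) := by
  apply continuous_sigma
  intro i
  have h1 : Continuous (fun x : I × stdSimplex ℝ (Fin (n + 1)) =>
      stdSimplex.map (Fin.succAbove i) x.2) :=
    (stdSimplex.continuous_map (Fin.succAbove i)).comp continuous_snd
  have h2 : Continuous (fun x : I × stdSimplex ℝ (Fin (n + 1)) =>
      (x.1, stdSimplex.map (Fin.succAbove i) x.2,
        (stdSimplex.barycenter : stdSimplex ℝ (Fin (n + 2))))) :=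
    continuous_fst.prodMk (h1.prodMk continuous_const)
  exact mix_continuous.comp h2

lemma bary {n : ℕ} (k : Fin (n + 2)) :
    (stdSimplex.barycenter : stdSimplex ℝ (Fin (n + 2))) k = 1 / ((n : ℝ) + 2) := by
  refine (stdSimplex.barycenter_apply (𝕜 := ℝ) k).trans ?_
  simp
  try norm_num

lemma par_surjective (n : ℕ) : Function.Surjective (par n) := by
  intro p
  obtain ⟨i, hi⟩ := Finite.exists_min (fun k => p k)
  have hN : (0 : ℝ) < (n : ℝ) + 2 := by positivity
  have hsum := stdSimplex.sum_eq_one p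
  have hle : ((n : ℝ) + 2) * p i ≤ 1 := by
    rw [← hsum]
    have := Finset.card_nsmul_le_sum Finset.univ (fun k => p k) (p i) (fun k _ => hi k)
    simpa using this
  have h0 : 0 ≤ ((n : ℝ) + 2) * p i := mul_nonneg hN.le (stdSimplex.zero_le p i)
  rcases hle.lt_or_eq with hlt | heq
  · have h1 : 0 < 1 - ((n : ℝ) + 2) * p i := by linarith
    have hxmem : (fun k => (p k - p i) / (1 - ((n : ℝ) + 2) * p i)) ∈
        stdSimplex ℝ (Fin (n + 2)) := by
      constructor
      · intro k
        exact div_nonneg (by linarith [hi k]) h1.le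
      · rw [← Finset.sum_div, Finset.sum_sub_distrib, hsum]
        simp only [Finset.sum_const, Finset.card_univ, Fintype.card_fin, nsmul_eq_mul]
        push_cast
        exact div_self h1.ne'
    obtain ⟨r, hr⟩ := exists_face ⟨_, hxmem⟩ i (by
      show (p i - p i) / _ = 0
      simp)
    refine ⟨⟨i, ⟨_, h0, hle⟩, r⟩, ?_⟩
    apply sext
    intro k
    rw [par, mix_apply]
    dsimp only
    rw [hr, bary]
    show _ * ((p k - p i) / (1 - ((n : ℝ) + 2) * p i)) + _ = _
    field_simp
    ring
  · refine ⟨⟨i, 1, stdSimplex.barycenter⟩, ?_⟩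
    rw [par]
    dsimp only
    rw [mix_one]
    have hpi : p i = 1 / ((n : ℝ) + 2) := by field_simp; linarith
    have hz : ∑ k, (p k - p i) = 0 := by
      rw [Finset.sum_sub_distrib, hsum]
      simp
      linarith
    rw [Finset.sum_eq_zero_iff_of_nonneg (fun k _ => by linarith [hi k])] at hz
    apply sext
    intro k
    rw [bary, ← hpi]
    linarith [hz k (Finset.mem_univ k)]

lemma par_t_le {n : ℕ} {x y : Σ _ : Fin (n + 2), I × stdSimplex ℝ (Fin (n + 1))}
    (h : par n x = par n y) : (y.2.1 : ℝ) ≤ x.2.1 := by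
  have hN : (0 : ℝ) < (n : ℝ) + 2 := by positivity
  have hk : par n x x.1 = par n y x.1 := by rw [h]
  rw [par, par, mix_apply, mix_apply, map_succAbove_self, bary] at hk
  have h1 : 0 ≤ (1 - (y.2.1 : ℝ)) * stdSimplex.map y.1.succAbove y.2.2 x.1 :=
    mul_nonneg (by linarith [y.2.1.2.2]) (stdSimplex.zero_le _ _)
  have h2 : (y.2.1 : ℝ) * (1 / ((n : ℝ) + 2)) ≤ x.2.1 * (1 / ((n : ℝ) + 2)) := by linarith
  exact le_of_mul_le_mul_right h2 (by positivity)

lemma par_inj {n : ℕ} {x y : Σ _ : Fin (n + 2), I × stdSimplex ℝ (Fin (n + 1))}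
    (h : par n x = par n y) : x.2.1 = y.2.1 ∧ (x.2.1 ≠ 1 →
      stdSimplex.map x.1.succAbove x.2.2 = stdSimplex.map y.1.succAbove y.2.2) := by
  have ht : x.2.1 = y.2.1 := Subtype.ext (le_antisymm (par_t_le h.symm) (par_t_le h))
  refine ⟨ht, fun hne => sext fun k => ?_⟩
  have hk : par n x k = par n y k := by rw [h]
  rw [par, par, mix_apply, mix_apply, ← ht] at hk
  have h1 : (1 - (x.2.1 : ℝ)) ≠ 0 := by
    intro h0
    apply hne
    apply Subtype.ext
    show (x.2.1 : ℝ) = 1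
    linarith
  exact mul_left_cancel₀ h1 (by linarith)

lemma fill {Y : Type} [TopologicalSpace Y] [ContractibleSpace Y] (n : ℕ)
    (f : Fin (n + 2) → C(stdSimplex ℝ (Fin (n + 1)), Y))
    (hf : ∀ i j q q', stdSimplex.map (Fin.succAbove i) q = stdSimplex.map (Fin.succAbove j) q' →
      f i q = f j q') :
    ∃ F : C(stdSimplex ℝ (Fin (n + 2)), Y), ∀ i q, F (stdSimplex.map (Fin.succAbove i) q) = f i q := by
  obtain ⟨y, ⟨H⟩⟩ := id_nullhomotopic Y
  let P : C(Σ _ : Fin (n + 2), I × stdSimplex ℝ (Fin (n + 1)), stdSimplex ℝ (Fin (n + 2))) :=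
    ⟨par n, par_continuous n⟩
  have hq : Topology.IsQuotientMap P :=
    (par_continuous n).isClosedMap.isQuotientMap (par_continuous n) (par_surjective n)
  let G : C(Σ _ : Fin (n + 2), I × stdSimplex ℝ (Fin (n + 1)), Y) :=
    ⟨fun x => H (x.2.1, f x.1 x.2.2), by
      apply continuous_sigma
      intro i
      dsimp only
      fun_prop⟩
  have hG : ∀ x y, par n x = par n y → G x = G y := by
    intro a b hab
    obtain ⟨h1, h2⟩ := par_inj hab
    show H (a.2.1, f a.1 a.2.2) = H (b.2.1, f b.1 b.2.2)
    by_cases h : a.2.1 = 1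
    · rw [← h1, h]
      simp
    · rw [← h1, hf _ _ _ _ (h2 h)]
  refine ⟨hq.lift G (fun a b (h : par n a = par n b) => hG a b h), fun i q => ?_⟩
  have h0 : stdSimplex.map (Fin.succAbove i) q = par n ⟨i, 0, q⟩ := by
    rw [par]
    dsimp only
    rw [mix_zero]
  rw [h0]
  have := congrArg (fun g => g ⟨i, 0, q⟩) (hq.lift_comp G (fun a b (h : par n a = par n b) => hG a b h))
  refine Eq.trans this ?_
  show H (0, f i q) = _
  simp

end FilteredAspherical

namespace FilteredAspherical

open CategoryTheory Simplicial Opposite unitInterval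

lemma wt_thin {J : Type} [Preorder J] {x y : WithTerminal J} (f g : x ⟶ y) : f = g := by
  cases y with
  | star => exact WithTerminal.starTerminal.hom_ext f g
  | of y =>
    cases x with
    | star => exact (WithTerminal.false_of_from_star f).elim
    | of x =>
      have : WithTerminal.down f = WithTerminal.down g := Subsingleton.elim _ _
      exact this

/-- cone map on objects -/
def coneT (n : ℕ) (i : Fin (n + 2)) : WithTerminal (Fin (n + 1)) :=
  if h : i.val < n + 1 then .of ⟨i.val, h⟩ else .star

lemma coneT_castSucc {n : ℕ} (i : Fin (n + 1)) : coneT n i.castSucc = .of i := by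
  unfold coneT
  exact dif_pos i.2

lemma coneT_last {n : ℕ} : coneT n (Fin.last _) = .star := by
  unfold coneT
  exact dif_neg (by simp)

lemma coneT_hom (n : ℕ) {i j : Fin (n + 2)} (h : i ≤ j) : Nonempty (coneT n i ⟶ coneT n j) := by
  unfold coneT
  by_cases hj : j.val < n + 1
  · have hi : i.val < n + 1 := lt_of_le_of_lt h hj
    rw [dif_pos hj, dif_pos hi]
    exact ⟨WithTerminal.incl.map (homOfLE h)⟩
  · rw [dif_neg hj]
    exact ⟨WithTerminal.starTerminal.from _⟩

/-- cone functor -/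
noncomputable def coneTF (n : ℕ) : Fin (n + 2) ⥤ WithTerminal (Fin (n + 1)) where
  obj i := coneT n i
  map f := (coneT_hom n (leOfHom f)).some
  map_id _ := wt_thin _ _
  map_comp _ _ := wt_thin _ _

variable {C : Type} [SmallCategory C] {t : C} (ht : Limits.IsTerminal t)

/-- cone on a simplex of the nerve -/
noncomputable def coneS {n : ℕ} (a : Fin (n + 1) ⥤ C) : Fin (n + 2) ⥤ C :=
  coneTF n ⋙ WithTerminal.liftToTerminal a ht

/-- cone on a monotone map -/
def coneHom {m n : ℕ} (θ : Fin (m + 1) →o Fin (n + 1)) : Fin (m + 2) →o Fin (n + 2) where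
  toFun i := if h : i.val < m + 1 then (θ ⟨i.val, h⟩).castSucc else Fin.last _
  monotone' i j hij := by
    dsimp only
    by_cases hj : j.val < m + 1
    · have hi : i.val < m + 1 := lt_of_le_of_lt hij hj
      rw [dif_pos hj, dif_pos hi]
      exact Fin.castSucc_le_castSucc_iff.2 (θ.monotone hij)
    · rw [dif_neg hj]
      exact Fin.le_last _

lemma coneHom_castSucc {m n : ℕ} (θ : Fin (m + 1) →o Fin (n + 1)) (i : Fin (m + 1)) :
    coneHom θ i.castSucc = (θ i).castSucc := by
  show (if h : i.val < m + 1 then _ else _) = _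
  rw [dif_pos i.2]
  rfl

lemma coneHom_last {m n : ℕ} (θ : Fin (m + 1) →o Fin (n + 1)) :
    coneHom θ (Fin.last _) = Fin.last _ := by
  simp [coneHom]

lemma functor_ext_thin {J K : Type} [SmallCategory J] [Preorder K]
    (F G : J ⥤ WithTerminal K) (h : ∀ j, F.obj j = G.obj j) : F = G :=
  CategoryTheory.Functor.ext h (fun _ _ _ => wt_thin _ _)

lemma lift_nat {J K : Type} [Preorder J] [Preorder K] (G : J ⥤ K) (a : K ⥤ C) :
    WithTerminal.liftToTerminal (G ⋙ a) ht =
      WithTerminal.map G ⋙ WithTerminal.liftToTerminal a ht := by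
  refine CategoryTheory.Functor.hext (fun X => ?_) (fun X Y f => ?_)
  · cases X <;> rfl
  · cases X with
    | of x =>
      cases Y with
      | of y => exact HEq.rfl
      | star => exact heq_of_eq (ht.hom_ext _ _)
    | star =>
      cases Y with
      | of y => exact (WithTerminal.false_of_from_star f).elim
      | star => exact heq_of_eq (ht.hom_ext _ _)

lemma coneS_nat {m n : ℕ} (θ : Fin (m + 1) →o Fin (n + 1)) (a : Fin (n + 1) ⥤ C) :
    coneS ht (θ.monotone.functor ⋙ a) = (coneHom θ).monotone.functor ⋙ coneS ht a := by
  unfold coneS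
  rw [lift_nat, ← Functor.assoc, ← Functor.assoc]
  congr 1
  apply functor_ext_thin
  intro j
  show (WithTerminal.map _).obj (coneT m j) = coneT n (coneHom θ j)
  rcases Fin.eq_castSucc_or_eq_last j with ⟨i, rfl⟩ | rfl
  · rw [coneHom_castSucc, coneT_castSucc, coneT_castSucc]
    rfl
  · rw [coneHom_last, coneT_last, coneT_last]
    rfl

lemma coneS_castSucc {n : ℕ} (a : Fin (n + 1) ⥤ C) :
    (Fin.strictMono_castSucc (n := n + 1)).monotone.functor ⋙ coneS ht a = a := by
  unfold coneS
  rw [← Functor.assoc]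
  have : (Fin.strictMono_castSucc (n := n + 1)).monotone.functor ⋙ coneTF n =
      WithTerminal.incl := by
    apply functor_ext_thin
    intro j
    show coneT n j.castSucc = .of j
    exact coneT_castSucc j
  rw [this]
  rfl

lemma coneS_last {n : ℕ} (a : Fin (n + 1) ⥤ C) :
    (coneS ht a).obj (Fin.last _) = t := by
  show (WithTerminal.liftToTerminal a ht).obj (coneT n (Fin.last _)) = t
  rw [coneT_last]
  rfl

end FilteredAspherical

namespace FilteredAspherical

open CategoryTheory Simplicial Opposite unitInterval

variable {C : Type} [SmallCategory C] {t : C} (ht : Limits.IsTerminal t)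

/-- the characteristic map of a simplex -/
noncomputable def chr (X : SSet.{0}) {n : ℕ} (a : X.obj (op ⦋n⦌)) :
    C(stdSimplex ℝ (Fin (n + 1)), SSet.toTop.obj X) :=
  TopCat.toSSetObjEquiv _ (op ⦋n⦌) ((sSetTopAdj.unit.app X).app (op ⦋n⦌) a)

lemma chr_map (X : SSet.{0}) {m n : ℕ} (θ : ⦋m⦌ ⟶ ⦋n⦌) (a : X.obj (op ⦋n⦌))
    (p : stdSimplex ℝ (Fin (m + 1))) :
    chr X (X.map θ.op a) p = chr X a (stdSimplex.map θ p) := by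
  have h := (sSetTopAdj.unit.app X).naturality_apply θ.op a
  unfold chr
  erw [h]
  rfl

/-- straight path to the cone point -/
noncomputable def conePath {n : ℕ} (p : stdSimplex ℝ (Fin (n + 1))) (s : I) :
    stdSimplex ℝ (Fin (n + 2)) :=
  mix s (stdSimplex.map Fin.castSucc p) (stdSimplex.vertex (Fin.last _))

lemma conePath_continuous {n : ℕ} :
    Continuous (fun x : stdSimplex ℝ (Fin (n + 1)) × I => conePath x.1 x.2) := by
  have h1 : Continuous (fun x : stdSimplex ℝ (Fin (n + 1)) × I =>
      stdSimplex.map (Fin.castSucc) x.1) :=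
    (stdSimplex.continuous_map (Fin.castSucc)).comp continuous_fst
  have h2 : Continuous (fun x : stdSimplex ℝ (Fin (n + 1)) × I =>
      (x.2, stdSimplex.map (Fin.castSucc) x.1,
        (stdSimplex.vertex (Fin.last _) : stdSimplex ℝ (Fin (n + 2))))) :=
    continuous_snd.prodMk (h1.prodMk continuous_const)
  exact mix_continuous.comp h2

lemma conePath_map {m n : ℕ} (θ : Fin (m + 1) →o Fin (n + 1)) (p : stdSimplex ℝ (Fin (m + 1)))
    (s : I) : stdSimplex.map (coneHom θ) (conePath p s) = conePath (stdSimplex.map θ p) s := by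
  unfold conePath
  rw [map_mix, stdSimplex.map_vertex, coneHom_last, stdSimplex.map_comp_apply,
    stdSimplex.map_comp_apply]
  have : (coneHom θ ∘ Fin.castSucc) = Fin.castSucc ∘ θ := funext (coneHom_castSucc θ)
  rw [this]

/-- path simplices -/
noncomputable def pathMap {n : ℕ} (a : Fin (n + 1) ⥤ C) :
    C(stdSimplex ℝ (Fin (n + 1)), C(I, SSet.toTop.obj (nerve C))) :=
  ContinuousMap.curry ⟨fun x => chr (nerve C) (n := n + 1) (coneS ht a) (conePath x.1 x.2),
    (ContinuousMap.continuous _).comp conePath_continuous⟩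

lemma pathMap_apply {n : ℕ} (a : Fin (n + 1) ⥤ C) (p s) :
    pathMap ht a p s = chr (nerve C) (n := n + 1) (coneS ht a) (conePath p s) := rfl

lemma pathMap_nat {m n : ℕ} (θ : Fin (m + 1) →o Fin (n + 1)) (a : Fin (n + 1) ⥤ C)
    (p : stdSimplex ℝ (Fin (m + 1))) :
    pathMap ht (θ.monotone.functor ⋙ a) p = pathMap ht a (stdSimplex.map θ p) := by
  ext s
  rw [pathMap_apply, pathMap_apply, coneS_nat, ← conePath_map]
  exact chr_map (nerve C) (SimplexCategory.mkHom (coneHom θ)) (coneS ht a) (conePath p s)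

lemma pathMap_zero {n : ℕ} (a : Fin (n + 1) ⥤ C) (p : stdSimplex ℝ (Fin (n + 1))) :
    pathMap ht a p 0 = chr (nerve C) (n := n) a p := by
  rw [pathMap_apply, conePath, mix_zero]
  have h := chr_map (nerve C) (SimplexCategory.mkHom
    ⟨Fin.castSucc, (Fin.strictMono_castSucc (n := n + 1)).monotone⟩) (coneS ht a) p
  refine h.symm.trans ?_
  congr 1
  exact congrArg (chr (nerve C) (n := n)) (coneS_castSucc ht a)

lemma pathMap_one {n : ℕ} (a : Fin (n + 1) ⥤ C) (p : stdSimplex ℝ (Fin (n + 1))) :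
    pathMap ht a p 1 = chr (nerve C) (n := 0) (ComposableArrows.mk₀ t) default := by
  rw [pathMap_apply, conePath, mix_one]
  have h := chr_map (nerve C) (SimplexCategory.mkHom (n := 0)
    ⟨fun _ => Fin.last (n + 1), fun _ _ _ => le_rfl⟩) (coneS ht a) (stdSimplex.vertex 0)
  refine Eq.trans ?_ (h.symm.trans ?_)
  · erw [stdSimplex.map_vertex]
    rfl
  · have h1 : (stdSimplex.vertex 0 : stdSimplex ℝ (Fin 1)) = default := Subsingleton.elim _ _
    rw [h1]
    congr 1
    refine congrArg (chr (nerve C) (n := 0)) ?_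
    exact ComposableArrows.ext₀ (coneS_last ht a)

/-- the simplicial map to the path space -/
noncomputable def pathS : nerve C ⟶ TopCat.toSSet.obj (TopCat.of C(I, SSet.toTop.obj (nerve C))) where
  app n := ↾ fun a => (TopCat.toSSetObjEquiv _ n).symm (pathMap ht (n := n.unop.len) a)
  naturality m n θ := by
    ext a
    apply (TopCat.toSSetObjEquiv _ n).injective
    ext1 p
    exact pathMap_nat ht θ.unop.toOrderHom a p

/-- evaluation -/
noncomputable def evm (Y : TopCat.{0}) (s : I) : TopCat.of C(I, Y) ⟶ Y :=
  TopCat.ofHom ⟨fun γ => γ s, by fun_prop⟩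

lemma contractible_of_terminal {C : Type} [SmallCategory C] {t : C} (ht : Limits.IsTerminal t) :
    ContractibleSpace (SSet.toTop.obj (nerve C)) := by
  let Φ := (sSetTopAdj.homEquiv _ _).symm (pathS ht)
  have h0 : Φ ≫ evm _ 0 = 𝟙 _ := by
    apply (sSetTopAdj.homEquiv _ _).injective
    rw [sSetTopAdj.homEquiv_naturality_right, Equiv.apply_symm_apply, sSetTopAdj.homEquiv_id]
    ext n a
    apply (TopCat.toSSetObjEquiv _ n).injective
    ext1 p
    exact pathMap_zero ht a p
  have h1 : Φ ≫ evm _ 1 = TopCat.ofHom (ContinuousMap.const _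
      (chr (nerve C) (n := 0) (ComposableArrows.mk₀ t) default)) := by
    apply (sSetTopAdj.homEquiv _ _).injective
    rw [sSetTopAdj.homEquiv_naturality_right, Equiv.apply_symm_apply, sSetTopAdj.homEquiv_unit]
    ext n a
    apply (TopCat.toSSetObjEquiv _ n).injective
    ext1 p
    exact pathMap_one ht a p
  rw [contractible_iff_id_nullhomotopic]
  refine ⟨chr (nerve C) (n := 0) (ComposableArrows.mk₀ t) default, ⟨?_⟩⟩
  refine ⟨⟨fun x => Φ x.2 x.1, ?_⟩, fun x => ?_, fun x => ?_⟩
  · have := (ContinuousMap.continuous_uncurry_of_continuous (Φ.hom : C(_, C(I, _)))).comp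
      (continuous_swap (X := I) (Y := SSet.toTop.obj (nerve C)))
    exact this
  · exact ConcreteCategory.congr_hom h0 x
  · exact ConcreteCategory.congr_hom h1 x

end FilteredAspherical


namespace FilteredAspherical

open CategoryTheory Simplicial Opposite unitInterval

lemma succAbove_swap {n : ℕ} {i j : Fin (n + 3)} {i' j' : Fin (n + 2)}
    (hj : i.succAbove j' = j) (hi : j.succAbove i' = i) (k : Fin (n + 1)) :
    i.succAbove (j'.succAbove k) = j.succAbove (i'.succAbove k) := by
  simp only [Fin.succAbove, Fin.lt_def, Fin.ext_iff] at *
  split_ifs at * <;> simp at * <;> omega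

lemma faces_compat {Y : TopCat.{0}} (n : ℕ) (g : (∂Δ[n + 1] : SSet.{0}) ⟶ TopCat.toSSet.obj Y)
    (f : Fin (n + 2) → C(stdSimplex ℝ (Fin (n + 1)), Y))
    (hfg : ∀ i, f i = TopCat.toSSetObjEquiv Y (op ⦋n⦌) (SSet.yonedaEquiv (SSet.boundary.ι i ≫ g)))
    (i j q q') (hq : stdSimplex.map (Fin.succAbove i) q = stdSimplex.map (Fin.succAbove j) q') :
    f i q = f j q' := by
  by_cases hij : i = j
  · subst hij
    rw [map_inj _ i.succAbove_right_injective hq]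
  obtain ⟨j', hj'⟩ := Fin.exists_succAbove_eq (Ne.symm hij)
  obtain ⟨i', hi'⟩ := Fin.exists_succAbove_eq hij
  have hqj : q j' = 0 := by
    rw [← map_inj_apply _ i.succAbove_right_injective q, hj', hq, map_succAbove_self]
  cases n with
  | zero =>
    have := stdSimplex.sum_eq_one q
    rw [Fin.sum_univ_one, Subsingleton.elim (0 : Fin 1) j', hqj] at this
    exact absurd this (by norm_num)
  | succ n =>
    obtain ⟨r, rfl⟩ := exists_face q j' hqj
    have hswap : (i.succAbove ∘ j'.succAbove) = (j.succAbove ∘ i'.succAbove) :=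
      funext (succAbove_swap hj' hi')
    have hq' : q' = stdSimplex.map i'.succAbove r := by
      apply map_inj _ j.succAbove_right_injective
      rw [← hq, stdSimplex.map_comp_apply, stdSimplex.map_comp_apply, hswap]
    subst hq'
    have hδ : SimplexCategory.δ j' ≫ SimplexCategory.δ i =
        SimplexCategory.δ i' ≫ SimplexCategory.δ j := by
      ext k
      exact congrArg _ (congrFun hswap k)
    have hcomp : SSet.stdSimplex.map (SimplexCategory.δ j') ≫ SSet.boundary.ι.{0} i =
        SSet.stdSimplex.map (SimplexCategory.δ i') ≫ SSet.boundary.ι j := by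
      rw [← cancel_mono (∂Δ[n + 1 + 1]).ι, Category.assoc, Category.assoc, SSet.boundary.ι_ι,
        SSet.boundary.ι_ι]
      show SSet.stdSimplex.map _ ≫ SSet.stdSimplex.map _ =
        SSet.stdSimplex.map _ ≫ SSet.stdSimplex.map _
      exact (CategoryTheory.Functor.map_comp SSet.stdSimplex _ _).symm.trans
        ((congrArg (fun k => SSet.stdSimplex.map k) hδ).trans
          (CategoryTheory.Functor.map_comp SSet.stdSimplex _ _))
    have key : ∀ (i : Fin (n + 3)) (j' : Fin (n + 2)), f i (stdSimplex.map j'.succAbove r) =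
        TopCat.toSSetObjEquiv Y (op ⦋n⦌) (SSet.yonedaEquiv
          (SSet.stdSimplex.map (SimplexCategory.δ j') ≫ SSet.boundary.ι i ≫ g)) r := by
      intro i j'
      rw [hfg, ← SSet.yonedaEquiv_naturality]
      rfl
    rw [key, key, reassoc_of% hcomp]

lemma rlp_contractible {Y : TopCat.{0}} [ContractibleSpace Y] (n : ℕ)
    (g : (∂Δ[n] : SSet.{0}) ⟶ TopCat.toSSet.obj Y) :
    ∃ G : Δ[n] ⟶ TopCat.toSSet.obj Y, ∂Δ[n].ι ≫ G = g := by
  cases n with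
  | zero =>
    obtain ⟨y⟩ : Nonempty Y := inferInstance
    exact ⟨SSet.yonedaEquiv.symm ((TopCat.toSSetObjEquiv Y (op ⦋0⦌)).symm (ContinuousMap.const _ y)),
      SSet.boundary.hom_ext₀⟩
  | succ n =>
    obtain ⟨F, hF⟩ := fill n _ (faces_compat n g _ (fun i => rfl))
    refine ⟨SSet.yonedaEquiv.symm ((TopCat.toSSetObjEquiv Y (op ⦋n + 1⦌)).symm F), ?_⟩
    apply SSet.boundary.hom_ext
    intro i
    rw [SSet.boundary.ι_ι_assoc]
    apply SSet.yonedaEquiv.injective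
    apply (TopCat.toSSetObjEquiv Y (op ⦋n⦌)).injective
    ext1 q
    rw [← hF i q]
    show TopCat.toSSetObjEquiv Y (op ⦋n⦌) (SSet.yonedaEquiv (SSet.stdSimplex.map (SimplexCategory.δ i) ≫ _)) q = _
    rw [← SSet.yonedaEquiv_naturality, Equiv.apply_symm_apply]
    rfl

variable (D : Type) [SmallCategory D]

/-- nerves of slices -/
abbrev sliceN : D ⥤ SSet.{0} := Over.mapFunctor D ⋙ nerveFunctor

/-- singular sets of realizations of nerves of slices -/
noncomputable abbrev sliceS : D ⥤ SSet.{0} := sliceN D ⋙ SSet.toTop ⋙ TopCat.toSSet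

variable {D}

/-- the canonical lift of a simplex to a slice -/
def liftO {n : ℕ} (a : Fin (n + 1) ⥤ D) : Fin (n + 1) ⥤ Over (a.obj (Fin.last n)) where
  obj i := Over.mk (a.map (homOfLE (Fin.le_last i)))
  map f := Over.homMk (a.map f) (by
    dsimp
    rw [← a.map_comp]
    rfl)
  map_id i := by
    ext
    simp
  map_comp f g := by
    ext
    simp

lemma homMk_heq {d X Y : D} {f f' : X ⟶ d} {g g' : Y ⟶ d} (hf : f = f') (hg : g = g')
    (k : X ⟶ Y) (w : k ≫ g = f) (w' : k ≫ g' = f') :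
    HEq (Over.homMk k w : Over.mk f ⟶ Over.mk g) (Over.homMk k w' : Over.mk f' ⟶ Over.mk g') := by
  subst hf hg
  rfl

lemma liftO_nat {m n : ℕ} (θ : Fin (m + 1) →o Fin (n + 1)) (a : Fin (n + 1) ⥤ D) :
    liftO (θ.monotone.functor ⋙ a) ⋙ Over.map (a.map (homOfLE (Fin.le_last (θ (Fin.last m))))) =
      θ.monotone.functor ⋙ liftO a := by
  have hm : ∀ i : Fin (m + 1), a.map (homOfLE (θ.monotone (Fin.le_last i))) ≫
      a.map (homOfLE (Fin.le_last (θ (Fin.last m)))) =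
      a.map (homOfLE (Fin.le_last (θ i))) := by
    intro i
    rw [← a.map_comp]
    rfl
  refine CategoryTheory.Functor.hext (fun i => congrArg Over.mk (hm i)) (fun i j f => ?_)
  refine homMk_heq (hm i) (hm j) (a.map (homOfLE (θ.monotone (leOfHom f)))) ?_ ?_
  · rw [← a.map_comp, ← a.map_comp, ← a.map_comp]
    rfl
  · rw [← a.map_comp]
    rfl

variable (D) in
/-- the cocone -/
noncomputable def sliceCocone : Limits.Cocone (sliceN D) where
  pt := nerve D
  ι := { app d := nerveMap (Over.forget d)
         naturality d e f := by
           ext n a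
           rfl }

variable (D) in
/-- the section -/
noncomputable def secN : nerve D ⟶ Limits.colimit (sliceN D) where
  app n := ↾ fun a => (Limits.colimit.ι (sliceN D) (CategoryTheory.Functor.obj (C := Fin (n.unop.len + 1)) a (Fin.last _))).app n
    (liftO (n := n.unop.len) a)
  naturality n m θ := by
    ext a
    have h := liftO_nat θ.unop.toOrderHom (n := n.unop.len) a
    have h2 := Limits.colimit.w (sliceN D) (CategoryTheory.Functor.map
      (C := Fin (n.unop.len + 1)) a
      (homOfLE (Fin.le_last (θ.unop.toOrderHom (Fin.last m.unop.len)))))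
    have h3 := ConcreteCategory.congr_hom (congr_app h2 m)
      (liftO (n := m.unop.len) (θ.unop.toOrderHom.monotone.functor ⋙
        (show Fin (n.unop.len + 1) ⥤ D from a)))
    have h4 := ConcreteCategory.congr_hom ((Limits.colimit.ι (sliceN D)
      (CategoryTheory.Functor.obj (C := Fin (n.unop.len + 1)) a (Fin.last _))).naturality θ)
      (liftO (n := n.unop.len) a)
    refine Eq.trans h3.symm (Eq.trans ?_ h4)
    exact congrArg (fun z => (Limits.colimit.ι (sliceN D)
      (CategoryTheory.Functor.obj (C := Fin (n.unop.len + 1)) a (Fin.last _))).app m z) h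

lemma secN_desc : secN D ≫ Limits.colimit.desc _ (sliceCocone D) = 𝟙 _ := by
  ext n a
  have h := Limits.colimit.ι_desc (sliceCocone D) (CategoryTheory.Functor.obj (C := Fin (n.unop.len + 1)) a (Fin.last _))
  have h2 := ConcreteCategory.congr_hom (congr_app h n) (liftO (n := n.unop.len) a)
  exact h2

lemma rlp_colim [IsFiltered D] {A B : SSet.{0}} (i : A ⟶ B) [Mono i]
    (g : A ⟶ Limits.colimit (sliceS D)) : ∃ G : B ⟶ Limits.colimit (sliceS D), i ≫ G = g := by
  have h : SSet.modelCategoryQuillen.I.rlp (Limits.terminal.from (Limits.colimit (sliceS D))) := by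
    rintro _ _ _ ⟨n⟩
    constructor
    intro f f' sq
    obtain ⟨d, p, hp⟩ := IsFinitelyPresentable.exists_hom_of_isColimit
      (Limits.colimit.isColimit (sliceS D)) f
    have : ContractibleSpace (SSet.toTop.obj ((sliceN D).obj d)) :=
      contractible_of_terminal (C := Over d) Over.mkIdTerminal
    obtain ⟨G, hG⟩ := rlp_contractible n p
    exact ⟨⟨{ l := G ≫ Limits.colimit.ι (sliceS D) d
              fac_left := by
                rw [reassoc_of% hG]
                exact hp
              fac_right := Limits.terminal.hom_ext _ _ }⟩⟩
  rw [← SSet.rlp_monomorphisms] at h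
  have := h i ‹_›
  have sq : CommSq g i (Limits.terminal.from _) (Limits.terminal.from _) :=
    ⟨Limits.terminal.hom_ext _ _⟩
  exact ⟨sq.lift, sq.fac_left⟩

lemma comp_incl_inj {C : Type} [SmallCategory C] {a b : C ⥤ D}
    (h : a ⋙ WithTerminal.incl = b ⋙ WithTerminal.incl) : a = b := by
  have ho : ∀ x, a.obj x = b.obj x := fun x =>
    WithTerminal.of.inj (CategoryTheory.Functor.congr_obj h x)
  obtain ⟨ao, am, _, _⟩ := a
  obtain ⟨bo, bm, _, _⟩ := b
  obtain rfl : ao = bo := funext ho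
  refine CategoryTheory.Functor.hext ho (fun x y f => ?_)
  have := CategoryTheory.Functor.hcongr_hom h f
  exact heq_of_eq (eq_of_heq this)

lemma fac_aux {J C E : Type*} [Category* J] [Category* C] [Category* E] {L : C ⥤ E} {R : E ⥤ C}
    (adj : L ⊣ R) (F : J ⥤ C) {C1 C2 N : C} (i1 : ∀ j, F.obj j ⟶ C1)
    (i2 : ∀ j, R.obj (L.obj (F.obj j)) ⟶ C2) (cm : C1 ⟶ C2)
    (hcm : ∀ j, i1 j ≫ cm = adj.unit.app (F.obj j) ≫ i2 j)
    (hext : ∀ (p q : C1 ⟶ R.obj (L.obj N)), (∀ j, i1 j ≫ p = i1 j ≫ q) → p = q)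
    (d1 : C1 ⟶ N) (d2 : C2 ⟶ R.obj (L.obj N)) (k : ∀ j, F.obj j ⟶ N)
    (h1 : ∀ j, i1 j ≫ d1 = k j) (h2 : ∀ j, i2 j ≫ d2 = R.map (L.map (k j))) :
    cm ≫ d2 = d1 ≫ adj.unit.app N := by
  apply hext
  intro j
  rw [← Category.assoc, hcm, Category.assoc, h2, ← Category.assoc, h1]
  exact (adj.unit.naturality (k j)).symm

lemma retract_aux {C E : Type*} [Category* C] [Category* E] {L : C ⥤ E} {R : E ⥤ C}
    (adj : L ⊣ R) {C1 C2 N W : C} (s : N ⟶ C1) (d1 : C1 ⟶ N) (cm : C1 ⟶ C2)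
    (d2 : C2 ⟶ R.obj (L.obj N)) (i : N ⟶ W) (g : W ⟶ C2) (hg : i ≫ g = s ≫ cm)
    (hfac : cm ≫ d2 = d1 ≫ adj.unit.app N) (hs : s ≫ d1 = 𝟙 _) :
    L.map i ≫ (adj.homEquiv _ _).symm (g ≫ d2) = 𝟙 _ := by
  apply (adj.homEquiv _ _).injective
  rw [adj.homEquiv_naturality_left, Equiv.apply_symm_apply, reassoc_of% hg, hfac,
    reassoc_of% hs, adj.homEquiv_id]

instance mono_incl : Mono (nerveMap (WithTerminal.incl (C := D))) := by
  have : ∀ n, Mono ((nerveMap (WithTerminal.incl (C := D))).app n) := by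
    intro n
    rw [mono_iff_injective]
    intro a b hab
    have hab' : (show Fin (n.unop.len + 1) ⥤ D from a) ⋙ WithTerminal.incl =
      (show Fin (n.unop.len + 1) ⥤ D from b) ⋙ WithTerminal.incl := hab
    exact comp_incl_inj hab'
  exact NatTrans.mono_of_mono_app _

end FilteredAspherical

open FilteredAspherical

/-- Every small filtered category is aspherical: its nerve is weakly equivalent to a
point. Since the geometric realization of a nerve is a CW complex, weak contractibility
is equivalently expressed as contractibility of the geometric realization of the nerve. -/
theorem stmt2 (D : Type) [SmallCategory D] [IsFiltered D] :
    ContractibleSpace (SSet.toTop.obj (nerve D)) := by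
  let u : sliceN D ⟶ sliceS D := Functor.whiskerLeft (sliceN D) sSetTopAdj.unit
  obtain ⟨G, hG⟩ := rlp_colim (nerveMap (WithTerminal.incl (C := D)))
    (secN D ≫ Limits.colimMap u)
  let c : Limits.Cocone (sliceS D) := (SSet.toTop ⋙ TopCat.toSSet).mapCocone (sliceCocone D)
  let d1 : Limits.colimit (sliceN D) ⟶ nerve D := Limits.colimit.desc _ (sliceCocone D)
  let d2 : Limits.colimit (sliceS D) ⟶ TopCat.toSSet.obj (SSet.toTop.obj (nerve D)) :=
    Limits.colimit.desc _ c
  have hfac : Limits.colimMap u ≫ d2 = d1 ≫ sSetTopAdj.unit.app (nerve D) :=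
    fac_aux sSetTopAdj (sliceN D) (fun d => Limits.colimit.ι (sliceN D) d)
      (fun d => Limits.colimit.ι (sliceS D) d) (Limits.colimMap u)
      (fun d => Limits.ι_colimMap u d) (fun p q h => Limits.colimit.hom_ext h) d1 d2
      (fun d => nerveMap (Over.forget d)) (fun d => Limits.colimit.ι_desc _ d)
      (fun d => Limits.colimit.ι_desc c d)
  let r : SSet.toTop.obj (nerve (WithTerminal D)) ⟶ SSet.toTop.obj (nerve D) :=
    (sSetTopAdj.homEquiv _ _).symm (G ≫ d2)
  have hr : SSet.toTop.map (nerveMap (WithTerminal.incl (C := D))) ≫ r = 𝟙 _ :=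
    retract_aux sSetTopAdj (secN D) d1 (Limits.colimMap u) d2 _ G hG hfac secN_desc
  have : ContractibleSpace (SSet.toTop.obj (nerve (WithTerminal D))) :=
    contractible_of_terminal WithTerminal.starTerminal
  rw [contractible_iff_id_nullhomotopic]
  obtain ⟨y, hy⟩ := id_nullhomotopic (SSet.toTop.obj (nerve (WithTerminal D)))
  refine ⟨r y, ?_⟩
  have h1 := (hy.comp (ContinuousMap.Homotopic.refl
    (SSet.toTop.map (nerveMap (WithTerminal.incl (C := D)))).hom))
  have h2 := (ContinuousMap.Homotopic.refl r.hom).comp h1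
  have e : r.hom.comp ((ContinuousMap.id _).comp
      (SSet.toTop.map (nerveMap (WithTerminal.incl (C := D)))).hom) = ContinuousMap.id _ := by
    ext x
    exact ConcreteCategory.congr_hom hr x
  rw [e] at h2
  exact h2
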